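/- Let L be a finite-dimensional p-nilpotent restricted Lie algebra over a field F of characteristic p > 0. Let Z̄ be a homogeneous basis of gr(L) = ⊕_{i≥1} D_i(L)/D_{i+1}(L) with a fixed set Z of coset representatives in L, totally ordered. Then for every k ≥ 1, the set of all PBW monomials in Z of weight at least k forms an F-basis of ω(L)^k. -/

import Mathlib

open UniversalEnvelopingAlgebra

attribute [local instance 100] LieRing.ofAssociativeRing

/-- A restricted Lie algebra over a field `F` of characteristic `p`: a Lie algebra equipped
with a `p`-map `x ↦ x^[p]` satisfying Jacobson's identities.  The additive identity
`(x+y)^[p] = x^[p] + y^[p] + Σ sᵢ(x,y)` (with `sᵢ` the Jacobson polynomials) is expressed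
faithfully inside the universal enveloping algebra, where it reads
`ι((x+y)^[p]) - ι(x^[p]) - ι(y^[p]) = (ι x + ι y)^p - (ι x)^p - (ι y)^p`. -/
class RestrictedLieAlgebra (p : ℕ) (F : Type*) (L : Type*) [Field F]
    [LieRing L] [LieAlgebra F L] : Type _ where
  pOp : L → L
  pOp_smul : ∀ (a : F) (x : L), pOp (a • x) = a ^ p • pOp x
  ad_pOp : ∀ x y : L, ⁅pOp x, y⁆ = ((LieAlgebra.ad F L x) ^ p) y
  pOp_add : ∀ x y : L,
    ι F (pOp (x + y)) - ι F (pOp x) - ι F (pOp y)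
      = (ι F x + ι F y) ^ p - (ι F x) ^ p - (ι F y) ^ p

namespace RestrictedLieAlgebra

variable (p : ℕ) (F : Type*) [Field F]

section Defs

variable (L : Type*) [LieRing L] [LieAlgebra F L] [RestrictedLieAlgebra p F L]

/-- The `p`-map of a restricted Lie algebra. -/
abbrev pmap (x : L) : L := RestrictedLieAlgebra.pOp (p := p) (F := F) x

/-- The relation defining the restricted enveloping algebra as a quotient of the
universal enveloping algebra: `x^p = x^[p]` for all `x ∈ L`. -/
def uRel : UniversalEnvelopingAlgebra F L → UniversalEnvelopingAlgebra F L → Prop :=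
  fun a b => ∃ x : L, a = (ι F x) ^ p ∧ b = ι F (pmap p F L x)

/-- The restricted enveloping algebra `u(L)`: the quotient of the universal enveloping
algebra of `L` by the two-sided ideal generated by `{x^p - x^[p] : x ∈ L}`. -/
abbrev uEnv := RingQuot (uRel p F L)

/-- The canonical (linear) embedding `L → u(L)`. -/
def uemb : L →ₗ[F] uEnv p F L :=
  ((RingQuot.mkAlgHom F (uRel p F L)).toLinearMap).comp (ι F : L →ₗ⁅F⁆ _).toLinearMap

variable [Fact p.Prime]

/-- The augmentation map `ε : u(L) → F`, induced by `x ↦ 0` for `x ∈ L`. -/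
noncomputable def aug : uEnv p F L →ₐ[F] F :=
  RingQuot.liftAlgHom F
    ⟨(UniversalEnvelopingAlgebra.lift F) (0 : L →ₗ⁅F⁆ F), by
      rintro a b ⟨x, rfl, rfl⟩
      simp [UniversalEnvelopingAlgebra.lift_ι_apply,
        zero_pow (Nat.Prime.ne_zero (Fact.out : p.Prime))]⟩

/-- The augmentation ideal `ω(L)`, i.e. the kernel of the augmentation map, as a
subspace of `u(L)`. -/
noncomputable def omegaIdeal : Submodule F (uEnv p F L) :=
  LinearMap.ker (aug p F L).toLinearMap

/-- The image of `L` inside `u(L)`. -/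
def lSub : Submodule F (uEnv p F L) := LinearMap.range (uemb p F L)

end Defs

section Closure

variable {L : Type*} [LieRing L] [LieAlgebra F L] [RestrictedLieAlgebra p F L]

/-- The restricted subalgebra generated by a subset `S` of `L`: the smallest Lie
subalgebra containing `S` which is closed under the `p`-map. -/
def restrictedClosure (S : Set L) : LieSubalgebra F L :=
  sInf {K : LieSubalgebra F L | S ⊆ K ∧ ∀ x ∈ K, pmap p F L x ∈ K}

/-- For a subalgebra `N ⊆ L`, the restricted subalgebra `N^p` generated by all
`x^[p]`, `x ∈ N`. -/
def subPPow (K : LieSubalgebra F L) : LieSubalgebra F L :=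
  restrictedClosure p F (pmap p F L '' K)

end Closure

section PNilpotent

variable (L : Type*) [LieRing L] [LieAlgebra F L] [RestrictedLieAlgebra p F L]

/-- `L` is `p`-nilpotent if `L^{pˢ} = 0` for some `s`, where `L^p` denotes the restricted
subalgebra generated by all `x^[p]`. -/
def IsPNilpotent : Prop :=
  ∃ s : ℕ, (subPPow p F)^[s] (⊤ : LieSubalgebra F L) = ⊥

/-- The derived subalgebra `L' = γ₂(L)` as a submodule of `L`. -/
abbrev derivedSub : Submodule F L := (LieModule.lowerCentralSeries F L L 1).toSubmodule

/-- `L'_p`, the restricted subalgebra generated by `L'`, as a submodule. -/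
def derivedP : Submodule F L :=
  (restrictedClosure p F (derivedSub F L : Set L)).toSubmodule

/-- `L'^p + γ₃(L)`, as a submodule of `L`. -/
def mainIdeal : Submodule F L :=
  (subPPow p F (restrictedClosure p F (derivedSub F L : Set L))).toSubmodule
    ⊔ (LieModule.lowerCentralSeries F L L 2).toSubmodule

end PNilpotent

end RestrictedLieAlgebra

namespace RestrictedLieAlgebra

variable (p : ℕ) (F : Type*) [Field F] {L : Type*} [LieRing L] [LieAlgebra F L]
  [RestrictedLieAlgebra p F L] [Fact p.Prime]

/-- The height `ν(x)` of `x ∈ L`: the largest `n` with `x ∈ Dₙ(L) = L ∩ ω(L)ⁿ`. -/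
noncomputable def height (x : L) : ℕ :=
  sSup {n : ℕ | uemb p F L x ∈ (omegaIdeal p F L) ^ n}

/-- The PBW monomial `z₁^{a₁} ⋯ z_m^{a_m}` in `u(L)`. -/
noncomputable def pbwMonomial {m : ℕ} (z : Fin m → L) (a : Fin m → ℕ) : uEnv p F L :=
  ((List.finRange m).map (fun i => uemb p F L (z i) ^ a i)).prod

end RestrictedLieAlgebra

namespace RestrictedLieAlgebra

section CharP

variable {p : ℕ} [Fact p.Prime]

lemma cast_choose_prime_sub_one (R : Type*) [Ring R] [CharP R p] {i : ℕ} (hi : i < p) :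
    (((p - 1).choose i : ℕ) : R) = (-1) ^ i := by
  have hp : p.Prime := Fact.out
  induction i with
  | zero => simp
  | succ i ih =>
    have h := Nat.choose_succ_succ (p - 1) i
    rw [Nat.succ_eq_add_one, Nat.sub_add_cancel hp.one_le] at h
    have h0 : ((p.choose (i + 1) : ℕ) : R) = 0 :=
      (CharP.cast_eq_zero_iff R p _).2 (hp.dvd_choose_self (by omega) hi)
    rw [h, Nat.cast_add, ih (by omega)] at h0
    rw [pow_succ, mul_neg_one]
    exact eq_neg_of_add_eq_zero_right h0

lemma geom_sum₂_eq_sub_pow {R : Type*} [Ring R] [CharP R p] {x y : R} (h : Commute x y) :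
    ∑ i ∈ Finset.range p, x ^ i * y ^ (p - 1 - i) = (x - y) ^ (p - 1) := by
  have hp : p.Prime := Fact.out
  rw [sub_eq_add_neg, (h.neg_right).add_pow, Nat.sub_add_cancel hp.one_le]
  refine Finset.sum_congr rfl fun i hi => ?_
  have hi := Finset.mem_range.1 hi
  rw [cast_choose_prime_sub_one R hi, neg_pow y, mul_assoc, mul_assoc]
  congr 1
  rw [((Commute.one_left (y ^ (p - 1 - i))).neg_left.pow_left i).symm.eq, ← mul_assoc, ← pow_add,
    Nat.sub_add_cancel (by omega), ← cast_choose_prime_sub_one R (Nat.sub_lt hp.pos one_pos)]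
  simp

variable (F : Type*) [Field F] [CharP F p] {A : Type*} [Ring A] [Algebra F A]

lemma ad_pow_char [Nontrivial A] (a b : A) :
    (LieAlgebra.ad F A a ^ p) b = a ^ p * b - b * a ^ p := by
  have : CharP (Module.End F A) p :=
    charP_of_injective_algebraMap (algebraMap F (Module.End F A)).injective p
  rw [LieAlgebra.ad_eq_lmul_left_sub_lmul_right, Pi.sub_apply,
    sub_pow_char_of_commute _ (LinearMap.commute_mulLeft_right (R := F) a a)]
  simp

lemma ad_pow_char_sub_one [Nontrivial A] (a b : A) :
    (LieAlgebra.ad F A a ^ (p - 1)) b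
      = ∑ i ∈ Finset.range p, a ^ i * b * a ^ (p - 1 - i) := by
  have : CharP (Module.End F A) p :=
    charP_of_injective_algebraMap (algebraMap F (Module.End F A)).injective p
  rw [LieAlgebra.ad_eq_lmul_left_sub_lmul_right, Pi.sub_apply,
    ← geom_sum₂_eq_sub_pow (LinearMap.commute_mulLeft_right (R := F) a a), LinearMap.sum_apply]
  simp [mul_assoc]

end CharP

section UEnv

variable {F : Type*} [Field F] {L : Type*} [LieRing L] [LieAlgebra F L]

lemma adjoin_range_ι :
    Algebra.adjoin F (Set.range (ι F : L → UniversalEnvelopingAlgebra F L)) = ⊤ := by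
  have hs : Function.Surjective (mkAlgHom F L) := Quotient.mk_surjective
  have := congrArg (Subalgebra.map (mkAlgHom F L)) (TensorAlgebra.adjoin_range_ι (R := F) (M := L))
  rw [AlgHom.map_adjoin, Algebra.map_top, (AlgHom.range_eq_top _).2 hs, ← Set.range_comp] at this
  exact this

variable (p : ℕ) [RestrictedLieAlgebra p F L]

lemma uemb_lie (x y : L) :
    uemb p F L ⁅x, y⁆ = uemb p F L x * uemb p F L y - uemb p F L y * uemb p F L x := by
  simp only [uemb, LinearMap.comp_apply, AlgHom.toLinearMap_apply, LieHom.coe_toLinearMap,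
    LieHom.map_lie, LieRing.of_associative_ring_bracket, map_sub, map_mul]

/-- The canonical embedding `L → u(L)` as a morphism of Lie algebras. -/
def uembLie : L →ₗ⁅F⁆ uEnv p F L :=
  { uemb p F L with
    map_lie' := fun {x y} => by
      rw [LieRing.of_associative_ring_bracket]; exact uemb_lie p x y }

lemma uemb_pow (x : L) : uemb p F L x ^ p = uemb p F L (pmap p F L x) := by
  simp only [uemb, LinearMap.comp_apply, AlgHom.toLinearMap_apply, LieHom.coe_toLinearMap,
    ← map_pow]
  exact RingQuot.mkAlgHom_rel F ⟨x, rfl, rfl⟩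

lemma adjoin_range_uemb : Algebra.adjoin F (Set.range (uemb p F L)) = ⊤ := by
  have := congrArg (Subalgebra.map (RingQuot.mkAlgHom F (uRel p F L)))
    (adjoin_range_ι (F := F) (L := L))
  rw [AlgHom.map_adjoin, Algebra.map_top,
    (AlgHom.range_eq_top _).2 (RingQuot.mkAlgHom_surjective F _), ← Set.range_comp] at this
  exact this

variable {B : Type*} [Ring B] [Algebra F B]

/-- The universal property of the restricted enveloping algebra. -/
noncomputable def uLift (ρ : L →ₗ⁅F⁆ B) (hρ : ∀ x, ρ x ^ p = ρ (pmap p F L x)) :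
    uEnv p F L →ₐ[F] B :=
  RingQuot.liftAlgHom F ⟨UniversalEnvelopingAlgebra.lift F ρ, by
    rintro a b ⟨x, rfl, rfl⟩
    rw [map_pow, UniversalEnvelopingAlgebra.lift_ι_apply,
      UniversalEnvelopingAlgebra.lift_ι_apply, hρ]⟩

lemma uLift_uemb (ρ : L →ₗ⁅F⁆ B) (hρ : ∀ x, ρ x ^ p = ρ (pmap p F L x)) (x : L) :
    uLift p ρ hρ (uemb p F L x) = ρ x := by
  simp only [uLift, uemb, LinearMap.comp_apply, AlgHom.toLinearMap_apply,
    LieHom.coe_toLinearMap, RingQuot.liftAlgHom_mkAlgHom_apply,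
    UniversalEnvelopingAlgebra.lift_ι_apply]

lemma aug_uemb [Fact p.Prime] (x : L) : aug p F L (uemb p F L x) = 0 := by
  simp only [aug, uemb, LinearMap.comp_apply, AlgHom.toLinearMap_apply,
    LieHom.coe_toLinearMap, RingQuot.liftAlgHom_mkAlgHom_apply,
    UniversalEnvelopingAlgebra.lift_ι_apply]
  rfl

lemma nontrivial_uEnv [Fact p.Prime] : Nontrivial (uEnv p F L) :=
  (aug p F L).toRingHom.domain_nontrivial

/-- Jacobson's identity holds in every associative algebra receiving a Lie morphism from `L`. -/
lemma map_pmap_add (ρ : L →ₗ⁅F⁆ B) (x y : L) :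
    ρ (pmap p F L (x + y)) - ρ (pmap p F L x) - ρ (pmap p F L y)
      = (ρ x + ρ y) ^ p - ρ x ^ p - ρ y ^ p := by
  have := congrArg (UniversalEnvelopingAlgebra.lift F ρ) (pOp_add (p := p) (F := F) x y)
  simpa only [map_sub, map_pow, map_add, UniversalEnvelopingAlgebra.lift_ι_apply] using this

end UEnv

section Derivation

variable {F A : Type*} [Field F] [Ring A] [Algebra F A]

/-- A linear endomorphism satisfying the Leibniz rule extracted from an algebra morphism into the
dual numbers that lifts the identity. -/
lemma exists_derivation_of_dualNumber (g : A →ₐ[F] DualNumber A)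
    (hg : ∀ a, TrivSqZeroExt.fst (g a) = a) :
    ∃ δ : A →ₗ[F] A, (∀ a, δ a = TrivSqZeroExt.snd (g a)) ∧
      ∀ a b, δ (a * b) = a * δ b + δ a * b := by
  refine ⟨(TrivSqZeroExt.sndHom A A).restrictScalars F ∘ₗ g.toLinearMap, fun a => rfl, fun a b => ?_⟩
  simp [hg]

end Derivation

end RestrictedLieAlgebra

namespace RestrictedLieAlgebra

section CodimOne

variable {F : Type*} [Field F] {L : Type*} [LieRing L] [LieAlgebra F L]

lemma coe_ad_pow (I : LieIdeal F L) (a b : I) (n : ℕ) :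
    (((LieAlgebra.ad F I a ^ n) b : I) : L) = (LieAlgebra.ad F L a ^ n) b := by
  induction n with
  | zero => simp
  | succ n ih => rw [pow_succ', pow_succ', Module.End.mul_apply, Module.End.mul_apply, ← ih]; rfl

/-- A Lie morphism on an ideal of codimension one, together with the image of a complementary
element acting compatibly, extends to the whole Lie algebra. -/
lemma exists_extend_lieHom {I : LieIdeal F L} {f : L →ₗ[F] F} (hI : ∀ y, y ∈ I ↔ f y = 0)
    (hf : ∀ x y : L, f ⁅x, y⁆ = 0) {x : L} (hx : f x = 1) {B : Type*} [Ring B] [Algebra F B]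
    (ψ : I →ₗ⁅F⁆ B) (X : B) (hX : ∀ a : I, X * ψ a - ψ a * X = ψ ⁅x, a⁆) :
    ∃ φ : L →ₗ⁅F⁆ B, (∀ a : I, φ a = ψ a) ∧ φ x = X := by
  let π : L →ₗ[F] I := LinearMap.codRestrict I.toSubmodule
    (LinearMap.id - f.smulRight x) (fun y => (hI _).2 (by simp [hx]))
  have hπ : ∀ y, (π y : L) = y - f y • x := fun y => rfl
  refine ⟨{ (ψ : I →ₗ[F] B) ∘ₗ π + f.smulRight X with map_lie' := ?_ }, fun a => ?_, ?_⟩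
  · intro y y'
    have key : π ⁅y, y'⁆ = ⁅π y, π y'⁆ + f y • ⁅x, π y'⁆ - f y' • ⁅x, π y⁆ := by
      apply Subtype.ext
      have hs : ⁅y, x⁆ = -⁅x, y⁆ := (lie_skew y x).symm
      simp [hπ, hf]
      rw [hs]
      module
    have h1 := hX (π y)
    have h2 := hX (π y')
    change ψ (π ⁅y, y'⁆) + f ⁅y, y'⁆ • X = ⁅ψ (π y) + f y • X, ψ (π y') + f y' • X⁆
    rw [key, hf, zero_smul, add_zero]
    simp only [map_add, map_sub, map_smul, LieHom.map_lie, ← h1, ← h2,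
      LieRing.of_associative_ring_bracket, add_mul, mul_add, smul_mul_assoc, mul_smul_comm]
    module
  · have ha : f a = 0 := (hI _).1 a.2
    have : π a = a := Subtype.ext (by simp [hπ, ha])
    change ψ (π a) + f a • X = _
    rw [this, ha, zero_smul, add_zero]
  · have : π x = 0 := Subtype.ext (by simp [hπ, hx])
    change ψ (π x) + f x • X = _
    rw [this, hx, one_smul, map_zero, zero_add]

/-- The Lie morphism `a ↦ e a + ε e ⁅x, a⁆` into the dual numbers. -/
def dualLieHom {I : LieIdeal F L} (x : L) {A : Type*} [Ring A] [Algebra F A] (e : I →ₗ⁅F⁆ A) :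
    I →ₗ⁅F⁆ DualNumber A :=
  { toFun := fun a => TrivSqZeroExt.inl (e a) + TrivSqZeroExt.inr (e ⁅x, a⁆)
    map_add' := fun a b => by ext <;> simp
    map_smul' := fun c a => by ext <;> simp
    map_lie' := fun {a b} => by
      have h : ⁅x, ⁅a, b⁆⁆ = ⁅⁅x, a⁆, b⁆ + ⁅a, ⁅x, b⁆⁆ := by
        apply Subtype.ext
        simp
      ext
      · change TrivSqZeroExt.fst (TrivSqZeroExt.inl (e ⁅a, b⁆) + _) = _
        rw [LieHom.map_lie]
        simp [LieRing.of_associative_ring_bracket]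
      · simp only [h, LieRing.of_associative_ring_bracket, LieHom.map_lie, map_add]
        simp
        abel }

lemma fst_dualLieHom {I : LieIdeal F L} (x : L) {A : Type*} [Ring A] [Algebra F A]
    (e : I →ₗ⁅F⁆ A) (a : I) : TrivSqZeroExt.fst (dualLieHom x e a) = e a := by
  simp [dualLieHom]

lemma snd_dualLieHom {I : LieIdeal F L} (x : L) {A : Type*} [Ring A] [Algebra F A]
    (e : I →ₗ⁅F⁆ A) (a : I) : TrivSqZeroExt.snd (dualLieHom x e a) = e ⁅x, a⁆ := by
  simp [dualLieHom]

lemma exists_derivation_universalEnveloping (I : LieIdeal F L) (x : L) :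
    ∃ δ : UniversalEnvelopingAlgebra F I →ₗ[F] UniversalEnvelopingAlgebra F I,
      (∀ a : I, δ (ι F a) = ι F ⁅x, a⁆) ∧ ∀ a b, δ (a * b) = a * δ b + δ a * b := by
  let g := UniversalEnvelopingAlgebra.lift F (dualLieHom x (ι F : I →ₗ⁅F⁆ _))
  have hg : (TrivSqZeroExt.fstHom F _ _).comp g = AlgHom.id F _ := by
    ext a
    change TrivSqZeroExt.fst (g (ι F a)) = ι F a
    rw [UniversalEnvelopingAlgebra.lift_ι_apply, fst_dualLieHom]
  obtain ⟨δ, h1, h2⟩ := exists_derivation_of_dualNumber g (fun a => DFunLike.congr_fun hg a)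
  refine ⟨δ, fun a => ?_, h2⟩
  rw [h1, UniversalEnvelopingAlgebra.lift_ι_apply, snd_dualLieHom]

variable (p : ℕ) [RestrictedLieAlgebra p F L]

/-- An ideal of codimension one containing all `p`-th powers is a restricted Lie algebra.  The
additive Jacobson identity is detected on the universal enveloping algebra of the ideal, on which
the whole Lie algebra acts. -/
@[reducible] def restrictedIdeal {I : LieIdeal F L} {f : L →ₗ[F] F} (hI : ∀ y, y ∈ I ↔ f y = 0)
    (hf : ∀ x y : L, f ⁅x, y⁆ = 0) (hP : ∀ x, f (pmap p F L x) = 0) {x : L} (hx : f x = 1) :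
    RestrictedLieAlgebra p F I where
  pOp a := ⟨pmap p F L a, (hI _).2 (hP _)⟩
  pOp_smul c a := Subtype.ext (pOp_smul c (a : L))
  ad_pOp a b := by
    apply Subtype.ext
    rw [coe_ad_pow]
    exact ad_pOp (p := p) (F := F) (a : L) (b : L)
  pOp_add a b := by
    obtain ⟨δ, hδ, hmul⟩ := exists_derivation_universalEnveloping I x
    obtain ⟨φ, hφ, -⟩ := exists_extend_lieHom hI hf hx
      (((Algebra.lmul F (UniversalEnvelopingAlgebra F I) : _ →ₐ[F] _) : _ →ₗ⁅F⁆ _).comp (ι F))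
      δ (fun a => by
        ext u
        change δ (ι F a * u) - ι F a * δ u = ι F ⁅x, a⁆ * u
        rw [hmul, hδ]; abel)
    have key := map_pmap_add p φ (a : L) (b : L)
    have e1 : ∀ c : I, φ (pmap p F L c)
        = Algebra.lmul F (UniversalEnvelopingAlgebra F I) (ι F ⟨pmap p F L c, (hI _).2 (hP _)⟩) :=
      fun c => hφ ⟨pmap p F L c, (hI _).2 (hP _)⟩
    have e2 : ∀ c : I, φ c = Algebra.lmul F (UniversalEnvelopingAlgebra F I) (ι F c) := hφ
    rw [e1 a, e1 b, e2, e2, ← LieSubmodule.coe_add, e1 (a + b)] at key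
    apply Algebra.lmul_injective (R := F)
    simpa only [map_sub, map_pow, map_add] using key

end CodimOne

end RestrictedLieAlgebra

namespace RestrictedLieAlgebra

section CodimOneRank

variable {F : Type*} [Field F] {L : Type*} [LieRing L] [LieAlgebra F L]
  (p : ℕ) [Fact p.Prime] [RestrictedLieAlgebra p F L]

lemma ad_pow_map {A : Type*} [Ring A] [Algebra F A] (e : L →ₗ⁅F⁆ A) (x y : L) (n : ℕ) :
    (LieAlgebra.ad F A (e x) ^ n) (e y) = e ((LieAlgebra.ad F L x ^ n) y) := by
  induction n with
  | zero => simp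
  | succ n ih =>
    rw [pow_succ', pow_succ', Module.End.mul_apply, Module.End.mul_apply, ih]
    simp [LieAlgebra.ad_apply]

lemma ad_pow_sub_one_lie {I : LieIdeal F L} [RestrictedLieAlgebra p F I]
    (hI : ∀ a : I, (pmap p F I a : L) = pmap p F L a) (x : L) (a : I) :
    (LieAlgebra.ad F I a ^ (p - 1)) ⁅x, a⁆ = ⁅x, pmap p F I a⁆ := by
  have hp : p.Prime := Fact.out
  apply Subtype.ext
  rw [coe_ad_pow, LieSubmodule.coe_bracket, LieSubmodule.coe_bracket, hI, ← lie_skew x (pmap p F L (a : L))]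
  have := ad_pOp (p := p) (F := F) (a : L) x
  rw [this]
  obtain ⟨n, rfl⟩ : ∃ n, p = n + 1 := ⟨p - 1, by have := hp.pos; omega⟩
  rw [pow_succ, Module.End.mul_apply, LieAlgebra.ad_apply, ← lie_skew x (a : L), map_neg]
  simp

variable [CharP F p]

lemma exists_derivation_uEnv {I : LieIdeal F L} [RestrictedLieAlgebra p F I]
    (hI : ∀ a : I, (pmap p F I a : L) = pmap p F L a) (x : L) :
    ∃ δ : uEnv p F I →ₗ[F] uEnv p F I,
      (∀ a : I, δ (uemb p F I a) = uemb p F I ⁅x, a⁆) ∧ ∀ a b, δ (a * b) = a * δ b + δ a * b := by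
  have hp : p.Prime := Fact.out
  have : Nontrivial (uEnv p F I) := nontrivial_uEnv p
  let g := uLift p (dualLieHom x (uembLie (F := F) (L := I) p)) (fun a => by
    ext
    · rw [TrivSqZeroExt.fst_pow, fst_dualLieHom, fst_dualLieHom]
      exact uemb_pow p a
    · rw [TrivSqZeroExt.snd_pow_eq_sum, fst_dualLieHom, snd_dualLieHom, snd_dualLieHom,
        ← ad_pow_sub_one_lie p hI, ← ad_pow_map, ad_pow_char_sub_one, ← Finset.sum_range_reflect]
      refine Finset.sum_congr (s₁ := Finset.range p) rfl fun i hi => ?_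
      have hi := Finset.mem_range.1 hi
      rw [Nat.pred_eq_sub_one, Nat.sub_sub_self (by omega : i ≤ p - 1)]
      rfl)
  have hg : (TrivSqZeroExt.fstHom F _ _).comp g = AlgHom.id F _ := by
    apply AlgHom.ext_of_adjoin_eq_top (adjoin_range_uemb p)
    rintro _ ⟨a, rfl⟩
    change TrivSqZeroExt.fst (g (uemb p F I a)) = uemb p F I a
    rw [uLift_uemb, fst_dualLieHom]
    rfl
  obtain ⟨δ, h1, h2⟩ := exists_derivation_of_dualNumber g (fun a => DFunLike.congr_fun hg a)
  refine ⟨δ, fun a => ?_, h2⟩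
  rw [h1, uLift_uemb, snd_dualLieHom]
  rfl

/-- The derivation induced by `x` satisfies `δ ^ p = ad x^[p]`. -/
lemma derivation_uEnv_pow {I : LieIdeal F L} [RestrictedLieAlgebra p F I] {x : L}
    {δ : uEnv p F I →ₗ[F] uEnv p F I} (hδ : ∀ a : I, δ (uemb p F I a) = uemb p F I ⁅x, a⁆)
    (hmul : ∀ a b, δ (a * b) = a * δ b + δ a * b) {w : I} (hw : (w : L) = pmap p F L x)
    (b : uEnv p F I) : (δ ^ p) b = uemb p F I w * b - b * uemb p F I w := by
  have hp : p.Prime := Fact.out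
  have : Nontrivial (uEnv p F I) := nontrivial_uEnv p
  let lm : uEnv p F I →ₐ[F] Module.End F (uEnv p F I) := Algebra.lmul F (uEnv p F I)
  have hone : δ 1 = 0 := by simpa using hmul 1 1
  have had : ∀ (n : ℕ) (a : I), (LieAlgebra.ad F (Module.End F (uEnv p F I)) δ ^ n)
      (lm (uemb p F I a)) = lm (uemb p F I ((LieModule.toEnd F L I x ^ n) a)) := by
    intro n a
    induction n with
    | zero => simp
    | succ n ih =>
      rw [pow_succ', pow_succ', Module.End.mul_apply, Module.End.mul_apply, ih,
        LieAlgebra.ad_apply, LieRing.of_associative_ring_bracket, LieModule.toEnd_apply_apply]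
      generalize (LieModule.toEnd F L I x ^ n) a = c
      ext u
      change δ (uemb p F I c * u) - uemb p F I c * δ u = uemb p F I ⁅x, c⁆ * u
      rw [hmul, hδ, add_sub_cancel_left]
  have hw' : ∀ a : I, (LieModule.toEnd F L I x ^ p) a = ⁅w, a⁆ := by
    intro a
    apply Subtype.ext
    have h : ∀ n : ℕ, (((LieModule.toEnd F L I x ^ n) a : I) : L)
        = (LieAlgebra.ad F L x ^ n) a := by
      intro n
      induction n with
      | zero => simp
      | succ n ih =>
        rw [pow_succ', pow_succ', Module.End.mul_apply, Module.End.mul_apply, ← ih]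
        rfl
    rw [h, ← ad_pOp (p := p) (F := F) x (a : L)]
    change _ = ⁅(w : L), (a : L)⁆
    rw [hw]
  let T : Module.End F (uEnv p F I) :=
    δ ^ p - (LinearMap.mulLeft F (uemb p F I w) - LinearMap.mulRight F (uemb p F I w))
  have hT : ∀ c b, T (c * b) = c * T b := by
    intro c
    have hc : c ∈ Algebra.adjoin F (Set.range (uemb p F I)) := by
      rw [adjoin_range_uemb]; trivial
    induction hc using Algebra.adjoin_induction with
    | mem c hc =>
      obtain ⟨a, rfl⟩ := hc
      intro b
      have h := LinearMap.congr_fun (ad_pow_char (p := p) F δ (lm (uemb p F I a))) b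
      rw [had, hw'] at h
      change uemb p F I ⁅w, a⁆ * b
        = (δ ^ p) (uemb p F I a * b) - uemb p F I a * (δ ^ p) b at h
      rw [uemb_lie] at h
      change (δ ^ p) (uemb p F I a * b) - (uemb p F I w * (uemb p F I a * b)
        - uemb p F I a * b * uemb p F I w)
        = uemb p F I a * ((δ ^ p) b - (uemb p F I w * b - b * uemb p F I w))
      rw [← sub_add_cancel ((δ ^ p) (uemb p F I a * b)) (uemb p F I a * (δ ^ p) b), ← h]
      noncomm_ring
    | algebraMap r => intro b; simp [← Algebra.smul_def]
    | add c d _ _ hc hd => intro b; rw [add_mul, map_add, hc, hd, add_mul]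
    | mul c d _ _ hc hd => intro b; rw [mul_assoc, hc, hd, mul_assoc]
  have hpow : ∀ n, 0 < n → (δ ^ n) 1 = 0 := by
    intro n hn
    obtain ⟨n, rfl⟩ : ∃ k, n = k + 1 := ⟨n - 1, by omega⟩
    rw [pow_succ, Module.End.mul_apply, hone, map_zero]
  have hT1 : T 1 = 0 := by
    simp [T, hpow p hp.pos]
  have := hT b 1
  rw [hT1, mul_one, mul_zero] at this
  exact sub_eq_zero.1 this

/-- Right multiplication by a root of `t ^ n = w`, on the free module with basis
`1, t, …, t ^ (n - 1)`. -/
noncomputable def rootShift {A : Type*} [Ring A] (n : ℕ) [NeZero n] (w : A) :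
    (Fin n → A) →ₗ[A] (Fin n → A) :=
  (Pi.basisFun A (Fin n)).constr ℕ fun j =>
    if h : (j : ℕ) + 1 < n then Pi.single ⟨j + 1, h⟩ 1 else Pi.single 0 w

lemma rootShift_single {A : Type*} [Ring A] {n : ℕ} [NeZero n] (w : A) (j : Fin n) (a : A) :
    rootShift n w (Pi.single j a)
      = if h : (j : ℕ) + 1 < n then Pi.single ⟨j + 1, h⟩ a else Pi.single 0 (a * w) := by
  have : (Pi.single j a : Fin n → A) = a • Pi.basisFun A (Fin n) j := by
    rw [Pi.basisFun_apply, ← Pi.single_smul', smul_eq_mul, mul_one]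
  rw [this, map_smul, rootShift, Module.Basis.constr_basis]
  split_ifs <;> rw [← Pi.single_smul', smul_eq_mul]
  rw [mul_one]

lemma rootShift_pow_single_zero {A : Type*} [Ring A] {n : ℕ} [NeZero n] (w : A) (a : A) {k : ℕ}
    (hk : k < n) : (rootShift n w ^ k) (Pi.single 0 a) = Pi.single ⟨k, hk⟩ a := by
  induction k with
  | zero => simp
  | succ k ih =>
    rw [pow_succ', Module.End.mul_apply, ih (by omega), rootShift_single]
    simp [hk]

lemma rootShift_pow {A : Type*} [Ring A] {n : ℕ} [NeZero n] (w : A) (v : Fin n → A) :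
    (rootShift n w ^ n) v = fun j => v j * w := by
  have hn : 0 < n := Nat.pos_of_ne_zero (NeZero.ne n)
  have h0 : ∀ a, (rootShift n w ^ n) (Pi.single 0 a) = Pi.single 0 (a * w) := by
    intro a
    obtain ⟨k, hk⟩ : ∃ k, n = k + 1 := ⟨n - 1, by omega⟩
    have h1 : rootShift n w ^ n = rootShift n w * rootShift n w ^ k := by
      rw [← pow_succ']; exact congrArg _ hk
    rw [h1, Module.End.mul_apply, rootShift_pow_single_zero w a (by omega : k < n),
      rootShift_single, dif_neg (by simp; omega)]
  have hj : ∀ (j : Fin n) a, (rootShift n w ^ n) (Pi.single j a) = Pi.single j (a * w) := by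
    intro j a
    rw [← rootShift_pow_single_zero w a j.2, ← Module.End.mul_apply, ← pow_add, add_comm, pow_add,
      Module.End.mul_apply, h0, rootShift_pow_single_zero w _ j.2]
  conv_lhs => rw [← Finset.univ_sum_single v, map_sum]
  simp_rw [hj]
  exact Finset.univ_sum_single (fun j => v j * w)

end CodimOneRank

end RestrictedLieAlgebra

namespace RestrictedLieAlgebra

section InducedModule

variable {F : Type*} [Field F] {L : Type*} [LieRing L] [LieAlgebra F L]
  (p : ℕ) [Fact p.Prime] [CharP F p] [RestrictedLieAlgebra p F L]

/-- Given a derivation `δ` of `A` with `δ ^ p = ad w` and `δ w = 0`, the operator of left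
multiplication by `x` on the ring of polynomials of degree less than `p` in `x` subject to
`x a = a x + δ a` and `x ^ p = w`. -/
lemma exists_root_action {F A : Type*} [Field F] [CharP F p] [Ring A] [Algebra F A] [Nontrivial A]
    {δ : A →ₗ[F] A} (hmul : ∀ a b, δ (a * b) = a * δ b + δ a * b) {w : A} (hδw : δ w = 0)
    (hδp : ∀ b, (δ ^ p) b = w * b - b * w) :
    ∃ X : Module.End F (Fin p → A), (∀ (a : A) v, X (a • v) = a • X v + δ a • v) ∧
      (∀ v, (X ^ p) v = w • v) ∧
      ∀ (j : ℕ) (hj : j + 1 < p),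
        X (Pi.single ⟨j, by omega⟩ 1) = Pi.single ⟨j + 1, hj⟩ 1 := by
  have hp : p.Prime := Fact.out
  have : NeZero p := ⟨hp.ne_zero⟩
  have hone : δ 1 = 0 := by simpa using hmul 1 1
  have : CharP (Module.End F (Fin p → A)) p :=
    charP_of_injective_algebraMap (algebraMap F (Module.End F (Fin p → A))).injective p
  let S : Module.End F (Fin p → A) := (rootShift p w).restrictScalars F
  let δV : Module.End F (Fin p → A) := δ.compLeft (Fin p)
  have hδV : ∀ j a, δV (Pi.single j a) = Pi.single j (δ a) := by
    intro j a
    ext i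
    change δ ((Pi.single j a : Fin p → A) i) = _
    rcases eq_or_ne i j with rfl | h
    · simp
    · simp [h]
  have hSδ : Commute δV S := by
    refine LinearMap.pi_ext fun j a => ?_
    change δV (rootShift p w (Pi.single j a)) = rootShift p w (δV (Pi.single j a))
    rw [hδV, rootShift_single, rootShift_single]
    split_ifs
    · rw [hδV]
    · rw [hδV, hmul, hδw, mul_zero, zero_add]
  have hSpow : ∀ n v, (S ^ n) v = (rootShift p w ^ n) v := by
    intro n
    induction n with
    | zero => intro v; rfl
    | succ n ih => intro v; rw [pow_succ', pow_succ', Module.End.mul_apply, ih]; rfl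
  have hδVpow : ∀ n v, (δV ^ n) v = fun j => (δ ^ n) (v j) := by
    intro n
    induction n with
    | zero => intro v; rfl
    | succ n ih =>
      intro v
      simp only [pow_succ', Module.End.mul_apply, ih]
      rfl
  refine ⟨δV + S, fun a v => ?_, fun v => ?_, fun j hj => ?_⟩
  · have h : δV (a • v) = a • δV v + δ a • v := funext fun j => hmul a (v j)
    change δV (a • v) + rootShift p w (a • v) = a • (δV v + rootShift p w v) + δ a • v
    rw [h, map_smul, smul_add]
    abel
  · rw [add_pow_char_of_commute _ hSδ, LinearMap.add_apply, hSpow, hδVpow, rootShift_pow]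
    ext j
    simp [hδp]
  · rw [LinearMap.add_apply, hδV, hone, Pi.single_zero, zero_add]
    change rootShift p w _ = _
    rw [rootShift_single, dif_pos (by simpa using hj)]

/-- A restricted ideal `I` of codimension one containing all `p`-th powers satisfies
`p * dim u(I) ≤ dim u(L)`: the algebra `u(L)` acts on `u(I) ⊗ F[t]/(t ^ p - x^[p])`, which is
cyclic. -/
theorem rank_uEnv_ideal_le {I : LieIdeal F L} [RestrictedLieAlgebra p F I]
    (hcompat : ∀ a : I, (pmap p F I a : L) = pmap p F L a)
    {f : L →ₗ[F] F} (hI : ∀ y, y ∈ I ↔ f y = 0)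
    (hf : ∀ x y : L, f ⁅x, y⁆ = 0) (hP : ∀ x, f (pmap p F L x) = 0) {x : L} (hx : f x = 1) :
    (p : Cardinal) * Module.rank F (uEnv p F I) ≤ Module.rank F (uEnv p F L) := by
  have hp : p.Prime := Fact.out
  have : NeZero p := ⟨hp.ne_zero⟩
  have : Nontrivial (uEnv p F I) := nontrivial_uEnv p
  obtain ⟨δ, hδ, hmul⟩ := exists_derivation_uEnv p hcompat x
  let w : I := ⟨pmap p F L x, (hI _).2 (hP _)⟩
  have hδw : δ (uemb p F I w) = 0 := by
    have : ⁅x, w⁆ = 0 := by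
      apply Subtype.ext
      change ⁅x, pmap p F L x⁆ = 0
      rw [← lie_skew, neg_eq_zero]
      refine (ad_pOp (p := p) (F := F) x x).trans ?_
      obtain ⟨n, hn⟩ : ∃ n, p = n + 1 := ⟨p - 1, by have := hp.pos; omega⟩
      have h1 : LieAlgebra.ad F L x ^ p = LieAlgebra.ad F L x ^ n * LieAlgebra.ad F L x := by
        rw [← pow_succ]; exact congrArg _ hn
      rw [h1, Module.End.mul_apply, LieAlgebra.ad_apply, lie_self, map_zero]
    rw [hδ, this, map_zero]
  obtain ⟨X, hXsmul, hXpow, hXsingle⟩ := exists_root_action (p := p) hmul hδw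
    (derivation_uEnv_pow p hδ hmul (w := w) rfl)
  let V := Fin p → uEnv p F I
  let lm : uEnv p F I →ₐ[F] Module.End F V := Algebra.lsmul F F V
  obtain ⟨φ, hφ, hφx⟩ := exists_extend_lieHom hI hf hx
    ((lm : uEnv p F I →ₗ⁅F⁆ Module.End F V).comp (uembLie p)) X (fun a => by
      refine LinearMap.ext fun v => ?_
      change X (uemb p F I a • v) - uemb p F I a • X v = uemb p F I ⁅x, a⁆ • v
      rw [hXsmul, hδ, add_sub_cancel_left])
  have hφI : ∀ a : I, φ a = lm (uemb p F I a) := hφ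
  have hφx' : φ x ^ p = φ (pmap p F L x) := by
    rw [hφx]
    refine LinearMap.ext fun v => ?_
    rw [hXpow]
    exact (LinearMap.congr_fun (hφI w) v).symm
  have hres : ∀ y, φ y ^ p = φ (pmap p F L y) := by
    intro y
    let a : I := ⟨y - f y • x, (hI _).2 (by simp [hx])⟩
    have hy : (a : L) + f y • x = y := by simp [a]
    have key := map_pmap_add p φ (a : L) (f y • x)
    have h1 : φ (pmap p F L (a : L)) = φ (a : L) ^ p := by
      rw [hφI, ← map_pow, uemb_pow, ← hφI, hcompat]
    have h2 : φ (pmap p F L (f y • x)) = φ (f y • x) ^ p := by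
      rw [show pmap p F L (f y • x) = f y ^ p • pmap p F L x from pOp_smul (f y) x,
        map_smul, map_smul, smul_pow, hφx']
    rw [h1, h2, sub_left_inj, sub_left_inj, ← map_add, hy] at key
    exact key.symm
  let Θ : uEnv p F L →ₗ[F] V :=
    (LinearMap.applyₗ (Pi.single 0 1 : V)) ∘ₗ (uLift p φ hres).toLinearMap
  have hΘ : ∀ u, Θ u = uLift p φ hres u (Pi.single 0 1) := fun u => rfl
  have hstab : ∀ y, ∀ v ∈ LinearMap.range Θ, φ y v ∈ LinearMap.range Θ := by
    rintro y _ ⟨u, rfl⟩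
    refine ⟨uemb p F L y * u, ?_⟩
    rw [hΘ, hΘ, map_mul, uLift_uemb, Module.End.mul_apply]
  have hstabA : ∀ c : uEnv p F I, ∀ v ∈ LinearMap.range Θ, c • v ∈ LinearMap.range Θ := by
    intro c
    have hc : c ∈ Algebra.adjoin F (Set.range (uemb p F I)) := by
      rw [adjoin_range_uemb]; trivial
    induction hc using Algebra.adjoin_induction with
    | mem c hc =>
      obtain ⟨a, rfl⟩ := hc
      intro v hv
      have := hstab a v hv
      rwa [hφI] at this
    | algebraMap r => intro v hv; rw [algebraMap_smul]; exact Submodule.smul_mem _ r hv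
    | add c d _ _ hc hd => intro v hv; rw [add_smul]; exact add_mem (hc v hv) (hd v hv)
    | mul c d _ _ hc hd => intro v hv; rw [mul_smul]; exact hc _ (hd v hv)
  have hbasis : ∀ (j : ℕ) (hj : j < p), (Pi.single ⟨j, hj⟩ 1 : V) ∈ LinearMap.range Θ := by
    intro j
    induction j with
    | zero => intro hj; exact ⟨1, by rw [hΘ, map_one]; rfl⟩
    | succ j ih =>
      intro hj
      have h := hstab x _ (ih (by omega))
      have h2 : φ x (Pi.single ⟨j, by omega⟩ 1 : V) = Pi.single ⟨j + 1, hj⟩ 1 := by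
        rw [hφx]
        exact hXsingle j hj
      rwa [h2] at h
  have hsurj : Function.Surjective Θ := by
    intro v
    change v ∈ LinearMap.range Θ
    rw [← Finset.univ_sum_single v]
    refine Submodule.sum_mem _ fun j _ => ?_
    have := hstabA (v j) _ (hbasis j j.2)
    rwa [← Pi.single_smul', smul_eq_mul, mul_one] at this
  have := LinearMap.rank_le_of_surjective Θ hsurj
  rw [rank_fun_eq_lift_mul] at this
  simpa using this

end InducedModule

end RestrictedLieAlgebra

namespace RestrictedLieAlgebra

section PNil

variable {F : Type*} [Field F] {L : Type*} [LieRing L] [LieAlgebra F L]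
  (p : ℕ) [RestrictedLieAlgebra p F L]

lemma exists_iterate_pmap_eq_zero (hL : IsPNilpotent p F L) :
    ∃ s, ∀ x, (pmap p F L)^[s] x = 0 := by
  obtain ⟨s, hs⟩ := hL
  have key : ∀ k x, (pmap p F L)^[k] x ∈ (subPPow p F)^[k] (⊤ : LieSubalgebra F L) := by
    intro k x
    induction k with
    | zero => trivial
    | succ k ih =>
      rw [Function.iterate_succ_apply', Function.iterate_succ_apply', subPPow, restrictedClosure,
        ← SetLike.mem_coe, LieSubalgebra.coe_sInf, Set.mem_iInter₂]
      exact fun K hK => hK.1 ⟨_, ih, rfl⟩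
  refine ⟨s, fun x => ?_⟩
  have := key s x
  rwa [hs, LieSubalgebra.mem_bot] at this

lemma ad_pmap (x : L) : LieAlgebra.ad F L (pmap p F L x) = LieAlgebra.ad F L x ^ p :=
  LinearMap.ext fun y => ad_pOp x y

lemma ad_iterate_pmap (s : ℕ) (x : L) :
    LieAlgebra.ad F L ((pmap p F L)^[s] x) = LieAlgebra.ad F L x ^ p ^ s := by
  induction s with
  | zero => simp
  | succ s ih => rw [Function.iterate_succ_apply', ad_pmap, ih, ← pow_mul, pow_succ]

lemma uemb_iterate_pmap (s : ℕ) (x : L) :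
    uemb p F L ((pmap p F L)^[s] x) = uemb p F L x ^ p ^ s := by
  induction s with
  | zero => simp
  | succ s ih => rw [Function.iterate_succ_apply', ← uemb_pow, ih, ← pow_mul, pow_succ]

lemma isNilpotent_of_iterate_pmap [FiniteDimensional F L] {s : ℕ}
    (hs : ∀ x, (pmap p F L)^[s] x = 0) : LieRing.IsNilpotent L := by
  rw [LieAlgebra.isNilpotent_iff_forall (R := F)]
  intro x
  exact ⟨p ^ s, by rw [← ad_iterate_pmap, hs, map_zero]⟩

variable [Fact p.Prime]

lemma pmap_lie_mem_lowerCentralSeries (x y : L) :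
    ⁅pmap p F L x, y⁆ ∈ LieModule.lowerCentralSeries F L L 2 := by
  obtain ⟨n, hn⟩ : ∃ n, p = n + 2 :=
    ⟨p - 2, by have := (Fact.out : p.Prime).two_le; omega⟩
  rw [show ⁅pmap p F L x, y⁆ = (LieAlgebra.ad F L x ^ p) y from ad_pOp x y]
  have h : ∀ n, (LieAlgebra.ad F L x ^ n) y ∈ LieModule.lowerCentralSeries F L L n := by
    intro n
    induction n with
    | zero => simp
    | succ n ih =>
      rw [pow_succ', Module.End.mul_apply, LieModule.lowerCentralSeries_succ]
      exact LieSubmodule.lie_mem_lie (LieSubmodule.mem_top _) ih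
  exact LieModule.antitone_lowerCentralSeries F L L (by omega) (h p)

variable [CharP F p]

lemma pmap_add_of_isLieAbelian [IsLieAbelian L] (x y : L) :
    pmap p F L (x + y) = pmap p F L x + pmap p F L y := by
  rw [← sub_eq_zero, ← Module.forall_dual_apply_eq_zero_iff F]
  intro f
  let ρ : L →ₗ⁅F⁆ F :=
    { f with
      map_lie' := fun {x y} => by
        change f ⁅x, y⁆ = f x * f y - f y * f x
        rw [trivial_lie_zero, map_zero, mul_comm, sub_self] }
  have h : ρ (pmap p F L (x + y)) - ρ (pmap p F L x) - ρ (pmap p F L y) = 0 := by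
    rw [map_pmap_add, add_pow_char]
    ring
  rw [map_sub, map_add, ← sub_sub]
  exact h

lemma span_range_pmap_ne_top [IsLieAbelian L] [Nontrivial L] {s : ℕ}
    (hs : ∀ x, (pmap p F L)^[s] x = 0) :
    Submodule.span F (Set.range (pmap p F L)) ≠ ⊤ := by
  intro htop
  have h : ∀ k, Submodule.span F (Set.range (pmap p F L)^[k]) = ⊤ := by
    intro k
    induction k with
    | zero => simp
    | succ k ih =>
      rw [eq_top_iff, ← htop, Submodule.span_le]
      rintro _ ⟨x, rfl⟩
      have hx : x ∈ Submodule.span F (Set.range (pmap p F L)^[k]) := by rw [ih]; trivial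
      induction hx using Submodule.span_induction with
      | mem x hx =>
        obtain ⟨y, rfl⟩ := hx
        exact Submodule.subset_span ⟨y, Function.iterate_succ_apply' _ _ _⟩
      | zero =>
        have : pmap p F L 0 = 0 := by
          simpa using pmap_add_of_isLieAbelian (F := F) p (0 : L) 0
        rw [this]
        exact zero_mem _
      | add x y _ _ hx hy => rw [pmap_add_of_isLieAbelian]; exact add_mem hx hy
      | smul c x _ hx =>
        rw [show pmap p F L (c • x) = c ^ p • pmap p F L x from pOp_smul c x]
        exact Submodule.smul_mem _ _ hx
  have h0 := h s
  rw [eq_top_iff] at h0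
  have : (⊤ : Submodule F L) ≤ ⊥ := h0.trans (by
    rw [Submodule.span_le]
    rintro _ ⟨x, rfl⟩
    exact hs x)
  exact top_ne_bot (le_bot_iff.1 this)

/-- A nonzero `p`-nilpotent restricted Lie algebra admits a nonzero functional vanishing on all
commutators and all `p`-th powers. -/
lemma exists_functional [FiniteDimensional F L] [Nontrivial L] {s : ℕ}
    (hs : ∀ x, (pmap p F L)^[s] x = 0) :
    ∃ f : L →ₗ[F] F, (∀ x y : L, f ⁅x, y⁆ = 0) ∧ (∀ x, f (pmap p F L x) = 0) ∧ ∃ x, f x = 1 := by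
  have hnil := isNilpotent_of_iterate_pmap p hs
  let γ := LieModule.lowerCentralSeries F L L
  have hlie : ∀ x y : L, ⁅x, y⁆ ∈ γ 1 := fun x y => by
    change _ ∈ LieModule.lowerCentralSeries F L L 1
    rw [LieModule.lowerCentralSeries_succ]
    exact LieSubmodule.lie_mem_lie (LieSubmodule.mem_top _) (LieSubmodule.mem_top _)
  let W : Submodule F L := Submodule.span F (Set.range (pmap p F L)) ⊔ (γ 1).toSubmodule
  have hW : W ≠ ⊤ := by
    intro hW
    have h12 : γ 1 ≤ γ 2 := by
      change LieModule.lowerCentralSeries F L L 1 ≤ _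
      rw [LieModule.lowerCentralSeries_succ, LieSubmodule.lie_le_iff]
      rintro x - y -
      obtain ⟨a, ha, b, hb, rfl⟩ := Submodule.mem_sup.1 (hW ▸ Submodule.mem_top : x ∈ W)
      rw [add_lie]
      refine add_mem ?_ ?_
      · induction ha using Submodule.span_induction with
        | mem a ha => obtain ⟨a, rfl⟩ := ha; exact pmap_lie_mem_lowerCentralSeries p a y
        | zero => rw [zero_lie]; exact zero_mem _
        | add a b _ _ ha hb => rw [add_lie]; exact add_mem ha hb
        | smul c a _ ha => rw [smul_lie]; exact (γ 2).smul_mem c ha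
      · rw [← lie_skew]
        refine neg_mem ?_
        change _ ∈ LieModule.lowerCentralSeries F L L 2
        rw [LieModule.lowerCentralSeries_succ]
        exact LieSubmodule.lie_mem_lie (LieSubmodule.mem_top _) hb
    have hk : ∀ k, γ 1 ≤ γ (k + 1) := by
      intro k
      induction k with
      | zero => exact le_rfl
      | succ k ih =>
        refine h12.trans ?_
        change LieModule.lowerCentralSeries F L L (1 + 1) ≤
          LieModule.lowerCentralSeries F L L (k + 1 + 1)
        rw [LieModule.lowerCentralSeries_succ, LieModule.lowerCentralSeries_succ F L L (k + 1)]
        exact LieSubmodule.mono_lie_right _ ih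
    obtain ⟨k, hk'⟩ := (LieModule.isNilpotent_iff F L L).1 hnil
    have hbot : γ 1 = ⊥ := le_bot_iff.1 ((hk k).trans
      ((LieModule.antitone_lowerCentralSeries F L L (Nat.le_succ k)).trans hk'.le))
    have : IsLieAbelian L := ⟨fun x y => by
      have := hlie x y
      rwa [hbot, LieSubmodule.mem_bot] at this⟩
    refine span_range_pmap_ne_top p hs ?_
    rw [← hW]
    simp [W, hbot]
  obtain ⟨g, hg, hle⟩ := Submodule.exists_le_ker_of_lt_top W (lt_top_iff_ne_top.2 hW)
  obtain ⟨x, hx⟩ : ∃ x, g x ≠ 0 := by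
    by_contra! h
    exact hg (LinearMap.ext h)
  refine ⟨g, fun a b => hle (Submodule.mem_sup_right (hlie a b)),
    fun a => hle (Submodule.mem_sup_left (Submodule.subset_span ⟨a, rfl⟩)), (g x)⁻¹ • x, ?_⟩
  rw [map_smul, smul_eq_mul, inv_mul_cancel₀ hx]

end PNil

theorem pow_finrank_le_rank_uEnv (p : ℕ) [Fact p.Prime] {F : Type*} [Field F] [CharP F p]
    (d s : ℕ) {L : Type*} [LieRing L] [LieAlgebra F L] [RestrictedLieAlgebra p F L]
    [FiniteDimensional F L] (hd : Module.finrank F L = d) (hs : ∀ x, (pmap p F L)^[s] x = 0) :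
    (p : Cardinal) ^ d ≤ Module.rank F (uEnv p F L) := by
  induction d generalizing L with
  | zero =>
    have := nontrivial_uEnv (F := F) (L := L) p
    rw [pow_zero, Cardinal.one_le_iff_pos]
    exact rank_pos
  | succ d ih =>
    have : Nontrivial L := Module.nontrivial_of_finrank_eq_succ hd
    obtain ⟨f, hf, hP, x, hx⟩ := exists_functional p hs
    let I : LieIdeal F L := { LinearMap.ker f with lie_mem := fun {a b} _ => hf a b }
    have hI : ∀ y, y ∈ I ↔ f y = 0 := fun y => Iff.rfl
    let _ := restrictedIdeal p hI hf hP hx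
    have hcompat : ∀ a : I, (pmap p F I a : L) = pmap p F L a := fun a => rfl
    have hfin : Module.finrank F I = d := by
      have h := LinearMap.finrank_range_add_finrank_ker f
      have hr : LinearMap.range f = ⊤ := LinearMap.range_eq_top.2 fun c =>
        ⟨c • x, by rw [map_smul, hx, smul_eq_mul, mul_one]⟩
      rw [hr, finrank_top, Module.finrank_self, hd] at h
      have h' : Module.finrank F (LinearMap.ker f) = d := by omega
      exact h'
    have hsI : ∀ a : I, (pmap p F I)^[s] a = 0 := by
      intro a
      apply Subtype.ext
      have h : ∀ k, (((pmap p F I)^[k] a : I) : L) = (pmap p F L)^[k] a := by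
        intro k
        induction k with
        | zero => rfl
        | succ k ihk =>
          rw [Function.iterate_succ_apply', Function.iterate_succ_apply', hcompat, ihk]
      rw [h, hs]
      rfl
    have h := ih hfin hsI
    rw [pow_succ']
    exact (mul_le_mul_right h _).trans (rank_uEnv_ideal_le p hcompat hI hf hP hx)

end RestrictedLieAlgebra

namespace RestrictedLieAlgebra

section Straightening

variable (F : Type*) [Field F] {A : Type*} [Ring A] [Algebra F A] {m : ℕ} (e : Fin m → A)
  (h : Fin m → ℕ)

/-- The span of the products of words of length less than `n` and weight at least `w`. -/
def wordSpan (n w : ℕ) : Submodule F A :=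
  Submodule.span F {x | ∃ l : List (Fin m), l.length < n ∧ w ≤ (l.map h).sum ∧
    x = (l.map e).prod}

/-- The span of the ordered monomials with exponents less than `p` and weight at least `w`. -/
def monomialSpan (p w : ℕ) : Submodule F A :=
  Submodule.span F {x | ∃ a : Fin m → ℕ, (∀ i, a i < p) ∧ w ≤ ∑ i, a i * h i ∧
    x = ((List.finRange m).map fun i => e i ^ a i).prod}

variable {F e h}

lemma mul_mem_wordSpan (i : Fin m) {n w : ℕ} {v : A} (hv : v ∈ wordSpan F e h n w) :
    e i * v ∈ wordSpan F e h (n + 1) (h i + w) := by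
  induction hv using Submodule.span_induction with
  | mem v hv =>
    obtain ⟨l, hl, hw, rfl⟩ := hv
    exact Submodule.subset_span ⟨i :: l, by simpa using hl, by simpa using hw, by simp⟩
  | zero => rw [mul_zero]; exact zero_mem _
  | add u v _ _ hu hv => rw [mul_add]; exact add_mem hu hv
  | smul c v _ hv => rw [mul_smul_comm]; exact Submodule.smul_mem _ c hv

lemma mul_prod_mem_wordSpan {w : ℕ} {c : A} (hc : c ∈ Submodule.span F {x | ∃ k, w ≤ h k ∧ x = e k})
    {l : List (Fin m)} {n w' : ℕ} (hn : l.length + 1 < n) (hw' : w' ≤ w + (l.map h).sum) :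
    c * (l.map e).prod ∈ wordSpan F e h n w' := by
  induction hc using Submodule.span_induction with
  | mem c hc =>
    obtain ⟨k, hk, rfl⟩ := hc
    exact Submodule.subset_span ⟨k :: l, by simpa using hn,
      by rw [List.map_cons, List.sum_cons]; omega, by simp⟩
  | zero => rw [zero_mul]; exact zero_mem _
  | add u v _ _ hu hv => rw [add_mul]; exact add_mem hu hv
  | smul c v _ hv => rw [smul_mul_assoc]; exact Submodule.smul_mem _ c hv

lemma prod_sub_prod_mem_wordSpan_of_perm
    (hcomm : ∀ i j, e i * e j - e j * e i ∈ Submodule.span F {x | ∃ k, h i + h j ≤ h k ∧ x = e k})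
    {l₁ l₂ : List (Fin m)} (hl : l₁.Perm l₂) :
    (l₁.map e).prod - (l₂.map e).prod ∈ wordSpan F e h l₁.length (l₁.map h).sum := by
  induction hl with
  | nil => simp
  | cons i _ ih =>
    simp only [List.map_cons, List.prod_cons, List.sum_cons, List.length_cons, ← mul_sub]
    exact mul_mem_wordSpan i ih
  | swap i j l =>
    simp only [List.map_cons, List.prod_cons, ← mul_assoc, ← sub_mul]
    exact mul_prod_mem_wordSpan (hcomm j i) (by simp) (by simp [add_assoc])
  | trans h₁ _ ih₁ ih₂ =>
    rw [← h₁.length_eq, ← (h₁.map h).sum_eq] at ih₂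
    simpa using add_mem ih₁ ih₂

lemma perm_flatMap_replicate_count (l : List (Fin m)) :
    l.Perm ((List.finRange m).flatMap fun i => List.replicate (l.count i) i) := by
  rw [List.perm_iff_count]
  intro a
  rw [List.count_flatMap, Function.comp_def, ← Fin.sum_univ_def]
  simp [List.count_replicate]

theorem prod_mem_monomialSpan {p : ℕ} (hp : 2 ≤ p)
    (hcomm : ∀ i j, e i * e j - e j * e i ∈ Submodule.span F {x | ∃ k, h i + h j ≤ h k ∧ x = e k})
    (hpow : ∀ i, e i ^ p ∈ Submodule.span F {x | ∃ k, p * h i ≤ h k ∧ x = e k})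
    (l : List (Fin m)) : (l.map e).prod ∈ monomialSpan F e h p (l.map h).sum := by
  induction hn : l.length using Nat.strong_induction_on generalizing l with
  | _ n ih =>
    subst hn
    have hle : wordSpan F e h l.length (l.map h).sum ≤ monomialSpan F e h p (l.map h).sum := by
      rw [wordSpan, Submodule.span_le]
      rintro _ ⟨l', hl', hw, rfl⟩
      refine Submodule.span_mono ?_ (ih _ hl' l' rfl)
      rintro _ ⟨a, ha, hwa, rfl⟩
      exact ⟨a, ha, hw.trans hwa, rfl⟩
    have hperm : ∀ l', l.Perm l' → (l'.map e).prod ∈ monomialSpan F e h p (l.map h).sum →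
        (l.map e).prod ∈ monomialSpan F e h p (l.map h).sum := by
      intro l' hl' h'
      have := add_mem (hle (prod_sub_prod_mem_wordSpan_of_perm hcomm hl')) h'
      rwa [sub_add_cancel] at this
    by_cases hc : ∃ i, p ≤ l.count i
    · obtain ⟨i, hi⟩ := hc
      obtain ⟨r, hr⟩ := (List.replicate_sublist_iff.2 hi).exists_perm_append
      refine hperm _ hr (hle ?_)
      have hlen := hr.length_eq
      have hsum := (hr.map h).sum_eq
      rw [List.length_append, List.length_replicate] at hlen
      rw [List.map_append, List.sum_append, List.map_replicate, List.sum_replicate,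
        smul_eq_mul] at hsum
      rw [List.map_append, List.prod_append, List.map_replicate, List.prod_replicate]
      exact mul_prod_mem_wordSpan (hpow i) (by omega) hsum.le
    · push Not at hc
      refine hperm _ (perm_flatMap_replicate_count l) (Submodule.subset_span
        ⟨fun i => l.count i, hc, ?_, ?_⟩)
      · rw [((perm_flatMap_replicate_count l).map h).sum_eq, List.map_flatMap, List.flatMap_def,
          List.sum_flatten, List.map_map, Fin.sum_univ_def]
        simp [Function.comp_def]
      · rw [List.map_flatMap, List.flatMap_def, List.prod_flatten, List.map_map]
        simp [Function.comp_def]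

end Straightening

end RestrictedLieAlgebra

namespace RestrictedLieAlgebra

section Augmentation

variable {F : Type*} [Field F] {L : Type*} [LieRing L] [LieAlgebra F L]
  (p : ℕ) [RestrictedLieAlgebra p F L]

lemma eq_top_of_uemb_mul_mem {S : Submodule F (uEnv p F L)} (h1 : 1 ∈ S)
    (hS : ∀ x, ∀ v ∈ S, uemb p F L x * v ∈ S) : S = ⊤ := by
  have key : ∀ u : uEnv p F L, ∀ v ∈ S, u * v ∈ S := by
    intro u
    have hu : u ∈ Algebra.adjoin F (Set.range (uemb p F L)) := by
      rw [adjoin_range_uemb]; trivial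
    induction hu using Algebra.adjoin_induction with
    | mem u hu => obtain ⟨x, rfl⟩ := hu; exact hS x
    | algebraMap r => intro v hv; rw [← Algebra.smul_def]; exact S.smul_mem r hv
    | add c d _ _ hc hd => intro v hv; rw [add_mul]; exact add_mem (hc v hv) (hd v hv)
    | mul c d _ _ hc hd => intro v hv; rw [mul_assoc]; exact hc _ (hd v hv)
  exact eq_top_iff.2 fun u _ => by simpa using key u 1 h1

variable [Fact p.Prime]

lemma mem_omegaIdeal {u : uEnv p F L} : u ∈ omegaIdeal p F L ↔ aug p F L u = 0 := Iff.rfl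

lemma uemb_mem_omegaIdeal (x : L) : uemb p F L x ∈ omegaIdeal p F L := aug_uemb p x

lemma omegaIdeal_le_span :
    omegaIdeal p F L ≤ Submodule.span F {u | ∃ x v, u = uemb p F L x * v} := by
  let S := Submodule.span F {u | ∃ x v, u = uemb p F L x * v}
  have hS : F ∙ (1 : uEnv p F L) ⊔ S = ⊤ := by
    refine eq_top_of_uemb_mul_mem p
      (Submodule.mem_sup_left (Submodule.mem_span_singleton_self _)) fun x v _ => ?_
    exact Submodule.mem_sup_right (Submodule.subset_span ⟨x, v, rfl⟩)
  intro u hu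
  obtain ⟨a, ha, b, hb, rfl⟩ := Submodule.mem_sup.1 (hS ▸ Submodule.mem_top : u ∈ _ ⊔ S)
  obtain ⟨c, rfl⟩ := Submodule.mem_span_singleton.1 ha
  have hbω : S ≤ omegaIdeal p F L := by
    rw [Submodule.span_le]
    rintro _ ⟨x, v, rfl⟩
    change aug p F L _ = 0
    rw [map_mul, aug_uemb, zero_mul]
  rw [mem_omegaIdeal, map_add, (mem_omegaIdeal p).1 (hbω hb), map_smul, map_one, add_zero,
    smul_eq_mul, mul_one] at hu
  rw [hu, zero_smul, zero_add]
  exact hb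

lemma omegaIdeal_pow_le {X : ℕ → Submodule F (uEnv p F L)} (h0 : X 0 = ⊤)
    (hX : ∀ k x, ∀ v ∈ X k, uemb p F L x * v ∈ X (k + 1)) (k : ℕ) :
    omegaIdeal p F L ^ k ≤ X k := by
  have key : ∀ k, ∀ c, ∀ v ∈ omegaIdeal p F L ^ k, c * v ∈ X k := by
    intro k
    induction k with
    | zero => intro c v _; rw [h0]; trivial
    | succ k ih =>
      intro c v hv
      rw [pow_succ'] at hv
      induction hv using Submodule.mul_induction_on' with
      | mem_mul_mem a ha v hv =>
        have hca : c * a ∈ omegaIdeal p F L := by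
          rw [mem_omegaIdeal, map_mul, (mem_omegaIdeal p).1 ha, mul_zero]
        rw [← mul_assoc]
        have := omegaIdeal_le_span p hca
        generalize c * a = b at this
        induction this using Submodule.span_induction with
        | mem b hb =>
          obtain ⟨x, u, rfl⟩ := hb
          rw [mul_assoc]
          exact hX k x _ (ih u v hv)
        | zero => rw [zero_mul]; exact zero_mem _
        | add b d _ _ hb hd => rw [add_mul]; exact add_mem hb hd
        | smul r b _ hb => rw [smul_mul_assoc]; exact Submodule.smul_mem _ r hb
      | add v _ w _ hv hw => rw [mul_add]; exact add_mem hv hw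
  exact fun v hv => by simpa using key k 1 v hv

lemma omegaIdeal_pow_anti {k n : ℕ} (hk : 1 ≤ k) (hkn : k ≤ n) :
    omegaIdeal p F L ^ n ≤ omegaIdeal p F L ^ k := by
  induction n, hkn using Nat.le_induction with
  | base => exact le_rfl
  | succ n hn ih =>
    refine le_trans ?_ ih
    obtain ⟨j, rfl⟩ : ∃ j, n = j + 1 := ⟨n - 1, by omega⟩
    rw [pow_succ, pow_succ, mul_assoc]
    have h : omegaIdeal p F L * omegaIdeal p F L ≤ omegaIdeal p F L := by
      refine Submodule.mul_le.2 fun a ha b _ => ?_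
      rw [mem_omegaIdeal, map_mul, (mem_omegaIdeal p).1 ha, zero_mul]
    gcongr

lemma exists_omegaIdeal_pow_eq_bot [FiniteDimensional F L] {s : ℕ}
    (hs : ∀ x, (pmap p F L)^[s] x = 0) : ∃ N, omegaIdeal p F L ^ (N + 1) = ⊥ := by
  let ρ : L →ₗ⁅F⁆ Module.End F (uEnv p F L) :=
    ((Algebra.lmul F (uEnv p F L) : _ →ₐ[F] _) : _ →ₗ⁅F⁆ _).comp (uembLie p)
  let _ : LieRingModule L (uEnv p F L) := LieRingModule.compLieHom _ ρ
  have : LieModule F L (uEnv p F L) := LieModule.compLieHom _ ρ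
  have hact : ∀ (x : L) (u : uEnv p F L), ⁅x, u⁆ = uemb p F L x * u := fun _ _ => rfl
  have hnil : LieModule.IsNilpotent L (uEnv p F L) := by
    rw [LieModule.isNilpotent_iff_forall (R := F)]
    intro x
    refine ⟨p ^ s, LinearMap.ext fun u => ?_⟩
    have : ∀ n, (LieModule.toEnd F L (uEnv p F L) x ^ n) u = uemb p F L x ^ n * u := by
      intro n
      induction n with
      | zero => simp
      | succ n ih =>
        rw [pow_succ', Module.End.mul_apply, ih, LieModule.toEnd_apply_apply, hact, pow_succ',
          mul_assoc]
    rw [this, ← uemb_iterate_pmap, hs, map_zero, zero_mul, LinearMap.zero_apply]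
  obtain ⟨N, hN⟩ := (LieModule.isNilpotent_iff F L (uEnv p F L)).1 hnil
  refine ⟨N, le_bot_iff.1 ?_⟩
  have h := omegaIdeal_pow_le p
    (X := fun k => (LieModule.lowerCentralSeries F L (uEnv p F L) k).toSubmodule) (by simp)
    (fun k x v hv => by
      change _ ∈ LieModule.lowerCentralSeries F L (uEnv p F L) (k + 1)
      rw [LieModule.lowerCentralSeries_succ, ← hact]
      exact LieSubmodule.lie_mem_lie (LieSubmodule.mem_top _) hv) (N + 1)
  refine h.trans fun u hu => ?_
  have hu' := LieModule.antitone_lowerCentralSeries F L (uEnv p F L) (Nat.le_succ N) hu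
  rwa [hN] at hu'

lemma uemb_mem_omegaIdeal_pow_iff {N : ℕ} (hN : omegaIdeal p F L ^ (N + 1) = ⊥) {x : L}
    (hx : uemb p F L x ≠ 0) {n : ℕ} (hn : 1 ≤ n) :
    uemb p F L x ∈ omegaIdeal p F L ^ n ↔ n ≤ height p F x := by
  have hbdd : BddAbove {n : ℕ | uemb p F L x ∈ omegaIdeal p F L ^ n} := by
    refine ⟨N, fun n hn => ?_⟩
    by_contra! h
    have := omegaIdeal_pow_anti p (Nat.le_add_left 1 N) h hn
    rw [hN] at this
    exact hx this
  refine ⟨fun h => le_csSup hbdd h, fun h => omegaIdeal_pow_anti p hn h ?_⟩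
  exact Nat.sSup_mem ⟨1, by simpa using uemb_mem_omegaIdeal p x⟩ hbdd

end Augmentation

section PBW

variable {F : Type*} [Field F] {L : Type*} [LieRing L] [LieAlgebra F L]
  (p : ℕ) [RestrictedLieAlgebra p F L] {m : ℕ} {z : Fin m → L} {h : Fin m → ℕ}

lemma uemb_mem_span {P : Fin m → Prop} {x : L}
    (hx : x ∈ Submodule.span F {x | ∃ k, P k ∧ x = z k}) :
    uemb p F L x ∈ Submodule.span F {u | ∃ k, P k ∧ u = uemb p F L (z k)} := by
  have h := Submodule.mem_map_of_mem (f := uemb p F L) hx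
  rw [Submodule.map_span] at h
  refine Submodule.span_mono ?_ h
  rintro _ ⟨_, ⟨k, hk, rfl⟩, rfl⟩
  exact ⟨k, hk, rfl⟩

variable [Fact p.Prime]

/-- Any word of weight `w` is a combination of PBW monomials of weight at least `w`, provided that
brackets and `p`-th powers do not decrease weights. -/
lemma word_mem_monomialSpan
    (hlie : ∀ i j, ⁅z i, z j⁆ ∈ Submodule.span F {x | ∃ k, h i + h j ≤ h k ∧ x = z k})
    (hpow : ∀ i, pmap p F L (z i) ∈ Submodule.span F {x | ∃ k, p * h i ≤ h k ∧ x = z k})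
    (l : List (Fin m)) :
    (l.map fun i => uemb p F L (z i)).prod ∈
      monomialSpan F (fun i => uemb p F L (z i)) h p (l.map h).sum := by
  refine prod_mem_monomialSpan (Fact.out : p.Prime).two_le (fun i j => ?_) (fun i => ?_) l
  · rw [← uemb_lie]
    exact uemb_mem_span p (hlie i j)
  · rw [uemb_pow]
    exact uemb_mem_span p (hpow i)

lemma omegaIdeal_pow_le_span_words (hz : Submodule.span F (Set.range z) = ⊤) (hh : ∀ i, 1 ≤ h i)
    (k : ℕ) :
    omegaIdeal p F L ^ k ≤ Submodule.span F {u | ∃ l : List (Fin m), k ≤ (l.map h).sum ∧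
      u = (l.map fun i => uemb p F L (z i)).prod} := by
  let X : ℕ → Submodule F (uEnv p F L) := fun k =>
    Submodule.span F {u | ∃ l : List (Fin m), k ≤ (l.map h).sum ∧
      u = (l.map fun i => uemb p F L (z i)).prod}
  have hX : ∀ k x, ∀ v ∈ X k, uemb p F L x * v ∈ X (k + 1) := by
    intro k x v hv
    induction hv using Submodule.span_induction with
    | mem v hv =>
      obtain ⟨l, hl, rfl⟩ := hv
      have hx : x ∈ Submodule.span F (Set.range z) := by rw [hz]; trivial
      induction hx using Submodule.span_induction with
      | mem x hx =>
        obtain ⟨i, rfl⟩ := hx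
        refine Submodule.subset_span ⟨i :: l, ?_, by simp⟩
        have := hh i
        rw [List.map_cons, List.sum_cons]
        omega
      | zero => rw [map_zero, zero_mul]; exact zero_mem _
      | add x y _ _ hx hy => rw [map_add, add_mul]; exact add_mem hx hy
      | smul c x _ hx => rw [map_smul, smul_mul_assoc]; exact Submodule.smul_mem _ c hx
    | zero => rw [mul_zero]; exact zero_mem _
    | add u v _ _ hu hv => rw [mul_add]; exact add_mem hu hv
    | smul c v _ hv => rw [mul_smul_comm]; exact Submodule.smul_mem _ c hv
  refine omegaIdeal_pow_le p (X := X) ?_ hX k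
  refine eq_top_of_uemb_mul_mem p (Submodule.subset_span ⟨[], by simp, by simp⟩) fun x v hv => ?_
  refine Submodule.span_mono ?_ (hX 0 x v hv)
  rintro _ ⟨l, -, rfl⟩
  exact ⟨l, by omega, rfl⟩

lemma span_pbwMonomial_eq_top (hz : Submodule.span F (Set.range z) = ⊤) :
    Submodule.span F (Set.range fun a : Fin m → Fin p => pbwMonomial p F z fun i => a i) = ⊤ := by
  have hmem : ∀ x : L, x ∈ Submodule.span F {x | ∃ k : Fin m, 0 ≤ 0 ∧ x = z k} := by
    intro x
    have hx : x ∈ Submodule.span F (Set.range z) := by rw [hz]; trivial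
    refine Submodule.span_mono ?_ hx
    rintro _ ⟨k, rfl⟩
    exact ⟨k, le_rfl, rfl⟩
  have hwords := omegaIdeal_pow_le_span_words (h := fun _ => 1) p hz (fun _ => le_rfl)
  have hstr := word_mem_monomialSpan (z := z) (h := fun _ => 0) p (fun i j => hmem _)
    (fun i => hmem _)
  have hle : ∀ l : List (Fin m), (l.map fun i => uemb p F L (z i)).prod ∈ Submodule.span F
      (Set.range fun a : Fin m → Fin p => pbwMonomial p F z fun i => a i) := by
    intro l
    refine Submodule.span_mono ?_ (hstr l)
    rintro _ ⟨a, ha, -, rfl⟩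
    exact ⟨fun i => ⟨a i, ha i⟩, rfl⟩
  have hω : omegaIdeal p F L ≤ Submodule.span F
      (Set.range fun a : Fin m → Fin p => pbwMonomial p F z fun i => a i) := by
    rw [← pow_one (omegaIdeal p F L)]
    refine (hwords 1).trans (Submodule.span_le.2 ?_)
    rintro _ ⟨l, -, rfl⟩
    exact hle l
  refine eq_top_iff.2 fun u _ => ?_
  have h1 : u - aug p F L u • 1 ∈ omegaIdeal p F L := by
    rw [mem_omegaIdeal, map_sub, map_smul, map_one, smul_eq_mul, mul_one, sub_self]
  have := add_mem (hω h1) (Submodule.smul_mem _ (aug p F L u) (hle []))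
  rwa [List.map_nil, List.prod_nil, sub_add_cancel] at this

theorem linearIndependent_pbwMonomial [CharP F p] [FiniteDimensional F L] {s : ℕ}
    (hs : ∀ x, (pmap p F L)^[s] x = 0) (hind : LinearIndependent F z)
    (hz : Submodule.span F (Set.range z) = ⊤) :
    LinearIndependent F fun a : Fin m → Fin p => pbwMonomial p F z fun i => a i := by
  have htop := span_pbwMonomial_eq_top p hz
  have : FiniteDimensional F (uEnv p F L) := 
    Module.finite_def.2 (htop ▸ Submodule.fg_span (Set.finite_range _))
  refine linearIndependent_of_top_le_span_of_card_le_finrank htop.ge ?_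
  have hm : Module.finrank F L = m := by
    rw [Module.finrank_eq_card_basis (Module.Basis.mk hind hz.ge), Fintype.card_fin]
  have h := pow_finrank_le_rank_uEnv p m s hm hs
  rw [← Module.finrank_eq_rank] at h
  rw [Fintype.card_fun, Fintype.card_fin, Fintype.card_fin]
  exact_mod_cast h

lemma uemb_ne_zero_of_linearIndependent_pbwMonomial
    (hli : LinearIndependent F fun a : Fin m → Fin p => pbwMonomial p F z fun i => a i)
    (i : Fin m) : uemb p F L (z i) ≠ 0 := by
  have hp := (Fact.out : p.Prime).two_le
  intro h0
  exact hli.ne_zero (fun _ => ⟨1, hp⟩)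
    (List.prod_eq_zero (List.mem_map.2 ⟨i, List.mem_finRange i, by simp [h0]⟩))

lemma pbwMonomial_mem_omegaIdeal_pow (hmem : ∀ i, uemb p F L (z i) ∈ omegaIdeal p F L ^ h i)
    (a : Fin m → ℕ) : pbwMonomial p F z a ∈ omegaIdeal p F L ^ ∑ i, a i * h i := by
  rw [pbwMonomial, Fin.sum_univ_def]
  induction List.finRange m with
  | nil => simpa using ⟨1, map_one (algebraMap F (uEnv p F L))⟩
  | cons i l ih =>
    simp only [List.map_cons, List.prod_cons, List.sum_cons]
    rw [pow_add, mul_comm (a i), pow_mul]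
    exact Submodule.mul_mem_mul (Submodule.pow_mem_pow _ (hmem i) _) ih

end PBW

end RestrictedLieAlgebra

open RestrictedLieAlgebra in
/-- Let `L` be finite-dimensional and `p`-nilpotent, and let `z : Fin m → L` be a set of
representatives of a homogeneous basis of `gr(L) = ⊕ Dᵢ(L)/Dᵢ₊₁(L)` (expressed by: the
`z i` are linearly independent and each `Dₙ(L)` is spanned by those `z i` lying in it).
Then for every `k ≥ 1` the PBW monomials in the `z i` of weight at least `k` form a
basis of `ω(L)^k`. -/
theorem pbw_monomials_weight_basis
    (p : ℕ) (F L : Type*) [Field F] [Fact p.Prime] [CharP F p]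
    [LieRing L] [LieAlgebra F L] [RestrictedLieAlgebra p F L]
    [FiniteDimensional F L] (hL : IsPNilpotent p F L)
    (m : ℕ) (z : Fin m → L)
    (hind : LinearIndependent F z)
    (hhom : ∀ n : ℕ, 1 ≤ n →
      Submodule.comap (uemb p F L) ((omegaIdeal p F L) ^ n)
        = Submodule.span F
            {x : L | ∃ i, x = z i ∧ uemb p F L (z i) ∈ (omegaIdeal p F L) ^ n}) :
    ∀ k : ℕ, 1 ≤ k →
      LinearIndependent F
        (fun a : {a : Fin m → ℕ //
              (∀ i, a i < p) ∧ k ≤ ∑ i, a i * height p F (z i)} =>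
          pbwMonomial p F z a.1) ∧
      Submodule.span F
        (Set.range (fun a : {a : Fin m → ℕ //
              (∀ i, a i < p) ∧ k ≤ ∑ i, a i * height p F (z i)} =>
          pbwMonomial p F z a.1)) = (omegaIdeal p F L) ^ k := by
  intro k hk
  obtain ⟨s, hs⟩ := exists_iterate_pmap_eq_zero p hL
  have hz : Submodule.span F (Set.range z) = ⊤ := by
    refine eq_top_iff.2 fun x _ => ?_
    have hx : x ∈ Submodule.comap (uemb p F L) (omegaIdeal p F L ^ 1) := by
      simpa using uemb_mem_omegaIdeal p x
    rw [hhom 1 le_rfl] at hx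
    refine Submodule.span_mono ?_ hx
    rintro _ ⟨i, rfl, -⟩
    exact ⟨i, rfl⟩
  have hli := linearIndependent_pbwMonomial p hs hind hz
  obtain ⟨N, hN⟩ := exists_omegaIdeal_pow_eq_bot p hs
  have hiff : ∀ i n, 1 ≤ n →
      (uemb p F L (z i) ∈ omegaIdeal p F L ^ n ↔ n ≤ height p F (z i)) := fun i n hn =>
    uemb_mem_omegaIdeal_pow_iff p hN (uemb_ne_zero_of_linearIndependent_pbwMonomial p hli i) hn
  have hone : ∀ i, 1 ≤ height p F (z i) := fun i =>
    (hiff i 1 le_rfl).1 (by simpa using uemb_mem_omegaIdeal p (z i))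
  have hmem : ∀ i, uemb p F L (z i) ∈ omegaIdeal p F L ^ height p F (z i) := fun i =>
    (hiff i _ (hone i)).2 le_rfl
  have hspan : ∀ n, 1 ≤ n → ∀ x, uemb p F L x ∈ omegaIdeal p F L ^ n →
      x ∈ Submodule.span F {x | ∃ i, n ≤ height p F (z i) ∧ x = z i} := by
    intro n hn x hx
    have hx' : x ∈ Submodule.comap (uemb p F L) (omegaIdeal p F L ^ n) := hx
    rw [hhom n hn] at hx'
    refine Submodule.span_mono ?_ hx'
    rintro _ ⟨i, rfl, hi⟩
    exact ⟨i, (hiff i n hn).1 hi, rfl⟩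
  have hstr := word_mem_monomialSpan (z := z) (h := fun i => height p F (z i)) p
    (fun i j => hspan _ (by have := hone i; omega) _ (by
      rw [uemb_lie]
      refine sub_mem ?_ ?_
      · rw [pow_add]
        exact Submodule.mul_mem_mul (hmem i) (hmem j)
      · rw [add_comm, pow_add]
        exact Submodule.mul_mem_mul (hmem j) (hmem i)))
    (fun i => hspan _ (Nat.mul_pos (Fact.out : p.Prime).pos (hone i)) _ (by
      rw [← uemb_pow, mul_comm, pow_mul]
      exact Submodule.pow_mem_pow _ (hmem i) _))
  refine ⟨?_, le_antisymm ?_ ?_⟩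
  · let g : {a : Fin m → ℕ // (∀ i, a i < p) ∧ k ≤ ∑ i, a i * height p F (z i)} →
        Fin m → Fin p := fun a i => ⟨a.1 i, a.2.1 i⟩
    have hg : Function.Injective g := fun a b hab =>
      Subtype.ext (funext fun i => congrArg Fin.val (congrFun hab i))
    exact hli.comp g hg
  · rw [Submodule.span_le]
    rintro _ ⟨⟨a, ha, hw⟩, rfl⟩
    exact omegaIdeal_pow_anti p hk hw (pbwMonomial_mem_omegaIdeal_pow p hmem a)
  · refine (omegaIdeal_pow_le_span_words p hz hone k).trans (Submodule.span_le.2 ?_)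
    rintro _ ⟨l, hl, rfl⟩
    refine Submodule.span_mono ?_ (hstr l)
    rintro _ ⟨a, ha, hw, rfl⟩
    exact ⟨⟨a, ha, hl.trans hw⟩, rfl⟩
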